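/- Let P be a polyline in general position with aco P > −π. Then all loops of P can be removed by successive loop removals, producing a simple polyline with the same endpoints as P whose rotation is at most rot P. -/

import Mathlib

open Real Set Pointwise

noncomputable section

/-- The signed angle from `v` to `w`, in `(-π, π]`; for nonzero non-opposite
vectors it lies in `(-π, π)` and its sign is the sign of the skew product. -/
def vangle (v w : ℝ × ℝ) : ℝ :=
  Complex.arg ((w.1 + w.2 * Complex.I) / (v.1 + v.2 * Complex.I))

/-- `w` is opposite to `v` : `w = a • v` with `a < 0`. -/
def Opp (v w : ℝ × ℝ) : Prop := ∃ a : ℝ, a < 0 ∧ w = a • v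

/-- A shift sequence is non-reverse if no two consecutive shifts are opposite. -/
def NonReverse (s : List (ℝ × ℝ)) : Prop := List.Chain' (fun v w => ¬ Opp v w) s

/-- The rotation of a polyline with the given shift sequence:
the sum of the signed angles between consecutive shifts. -/
def rotShifts : List (ℝ × ℝ) → ℝ
  | v :: w :: rest => vangle v w + rotShifts (w :: rest)
  | _ => 0

/-- The angular convexity of a polyline with shift sequence `s` :
the minimum of the rotations of its contiguous subpolylines. -/
def acoShifts (s : List (ℝ × ℝ)) : ℝ :=
  sInf (rotShifts '' { t : List (ℝ × ℝ) | t <:+: s })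

/-- The (cyclic) rotation of a closed polyline with shift sequence `s`. -/
def rotClosed (s : List (ℝ × ℝ)) : ℝ := rotShifts (s ++ s.take 1)

/-- The angular convexity of a closed polyline with shift sequence `s` :
the minimum of the rotations over all (possibly wrapping) contiguous
subpolylines traversing the cycle at most once, oriented along it. -/
def acoClosed (s : List (ℝ × ℝ)) : ℝ :=
  sInf (rotShifts '' { t : List (ℝ × ℝ) | t.length ≤ s.length ∧ t <:+: (s ++ s) })

/-- A polyline, given by its first vertex and its shift sequence. -/
structure Polyline where
  start : ℝ × ℝ
  shifts : List (ℝ × ℝ)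

namespace Polyline

/-- A genuine polyline: at least one edge and consecutive vertices distinct. -/
def Proper (P : Polyline) : Prop := P.shifts ≠ [] ∧ ∀ v ∈ P.shifts, v ≠ 0

/-- The `i`-th vertex (`0`-indexed). -/
def vert (P : Polyline) (i : ℕ) : ℝ × ℝ := P.start + (P.shifts.take i).sum

/-- The natural piecewise-linear parameterization of `P` on `[0, number of edges]`. -/
def param (P : Polyline) (t : ℝ) : ℝ × ℝ :=
  P.vert ⌊t⌋.toNat + Int.fract t • P.shifts.getD ⌊t⌋.toNat 0

/-- The polyline as a subset of the plane. -/
def trace (P : Polyline) : Set (ℝ × ℝ) := P.param '' Set.Icc 0 (P.shifts.length : ℝ)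

/-- A closed polyline: the last vertex equals the first one. -/
def Closed (P : Polyline) : Prop := P.shifts.sum = 0

/-- A simple (open) polyline: edges may intersect only at a common vertex of
consecutive edges, i.e. the natural parameterization is injective. -/
def Simple (P : Polyline) : Prop := Set.InjOn P.param (Set.Icc 0 (P.shifts.length : ℝ))

/-- A simple closed polyline: closed and injective except for first = last point. -/
def SimpleClosed (P : Polyline) : Prop :=
  P.Closed ∧ Set.InjOn P.param (Set.Ico 0 (P.shifts.length : ℝ))

/-- The `i`-th edge as a segment in the plane. -/
def edge (P : Polyline) (i : ℕ) : Set (ℝ × ℝ) := segment ℝ (P.vert i) (P.vert (i + 1))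

/-- A polyline is in general position if all vertices are distinct, two edges meet
in at most one point which is either the common vertex of consecutive edges or lies
in the relative interiors of both, and no three edges have a common point. -/
def GeneralPosition (P : Polyline) : Prop :=
  (∀ i j, i < j → j ≤ P.shifts.length → P.vert i ≠ P.vert j) ∧
  (∀ i j, i < j → j < P.shifts.length →
    (P.edge i ∩ P.edge j).Subsingleton ∧
    ∀ x ∈ P.edge i ∩ P.edge j,
      (j = i + 1 ∧ x = P.vert j) ∨
      (x ∈ openSegment ℝ (P.vert i) (P.vert (i + 1)) ∧
        x ∈ openSegment ℝ (P.vert j) (P.vert (j + 1)))) ∧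
  ∀ i j k, i < j → j < k → k < P.shifts.length →
    P.edge i ∩ P.edge j ∩ P.edge k = ∅

end Polyline

/-- `P` is the (anticlockwise-oriented) closed simple boundary polyline of the
simple polygon `K`. -/
structure IsSimplePolygon (K : Set (ℝ × ℝ)) (P : Polyline) : Prop where
  compact : IsCompact K
  regular : K = closure (interior K)
  proper : P.Proper
  nonReverse : NonReverse (P.shifts ++ P.shifts.take 1)
  simpleClosed : P.SimpleClosed
  boundary : frontier K = P.trace
  orient : rotClosed P.shifts = 2 * π

/-- The ray with apex `x` and direction `d`. -/
def ray (x d : ℝ × ℝ) : Set (ℝ × ℝ) := {y | ∃ t : ℝ, 0 ≤ t ∧ y = x + t • d}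

/-- The angular region with apex `x` spanned by the directions `u` and `v` :
the convex hull of the two rays. Its angular measure is `|vangle u v|`. -/
def angularRegion (x u v : ℝ × ℝ) : Set (ℝ × ℝ) :=
  convexHull ℝ (ray x u ∪ ray x v)

/-- The merge of two shift sequences used in the sorted sum: repeatedly take the
head of the remaining sequence with the larger rotation (preferring the first). -/
def sortedMerge : List (ℝ × ℝ) → List (ℝ × ℝ) → List (ℝ × ℝ)
  | [], t => t
  | s, [] => s
  | a :: s, b :: t =>
    if rotShifts (b :: t) ≤ rotShifts (a :: s) then a :: sortedMerge s (b :: t)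
    else b :: sortedMerge (a :: s) t
termination_by s t => s.length + t.length

/-- The hypotheses of the sorted sum: both polylines are proper and non-reverse,
their first shifts have the same direction, and their rotations are equal. -/
def SortedSumHyp (P Q : Polyline) : Prop :=
  P.Proper ∧ Q.Proper ∧ NonReverse P.shifts ∧ NonReverse Q.shifts ∧
  vangle P.shifts.headI Q.shifts.headI = 0 ∧
  rotShifts P.shifts = rotShifts Q.shifts

/-- The sorted sum `P +ₛ Q` : starts at the sum of the first vertices and has the
merged shift sequence. -/
def sortedSum (P Q : Polyline) : Polyline :=
  ⟨P.start + Q.start, sortedMerge P.shifts Q.shifts⟩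

/-- The shift sequence of the polyline obtained from `P` by the loop removal at
a self-intersection `P.param t₁ = P.param t₂` (`t₁ < t₂`): the part of `P`
before `t₁` (including the partial edge ending at `P.param t₁` when `t₁` is not
a vertex) concatenated with the part of `P` after `t₂`. -/
def removeLoop (P : Polyline) (t₁ t₂ : ℝ) : Polyline where
  start := P.start
  shifts :=
    P.shifts.take ⌊t₁⌋.toNat ++
    (if Int.fract t₁ = 0 then [] else [P.param t₁ - P.vert ⌊t₁⌋.toNat]) ++
    (if Int.fract t₂ = 0 then [] else [P.vert (⌊t₂⌋.toNat + 1) - P.param t₂]) ++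
    P.shifts.drop (⌊t₂⌋.toNat + if Int.fract t₂ = 0 then 0 else 1)

/-- The shift sequence of the subpolyline (loop) of `P` between `P.param t₁`
and `P.param t₂`. -/
def loopShifts (P : Polyline) (t₁ t₂ : ℝ) : List (ℝ × ℝ) :=
  (if Int.fract t₁ = 0 then [] else [P.vert (⌊t₁⌋.toNat + 1) - P.param t₁]) ++
  ((P.shifts.drop (⌊t₁⌋.toNat + if Int.fract t₁ = 0 then 0 else 1)).take
    (⌊t₂⌋.toNat - (⌊t₁⌋.toNat + if Int.fract t₁ = 0 then 0 else 1))) ++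
  (if Int.fract t₂ = 0 then [] else [P.param t₂ - P.vert ⌊t₂⌋.toNat])

/-- `R` is obtained from `P` by one loop removal. -/
def LoopRemovalStep (P R : Polyline) : Prop :=
  ∃ t₁ t₂ : ℝ, t₁ ∈ Set.Icc (0 : ℝ) (P.shifts.length : ℝ) ∧
    t₂ ∈ Set.Icc (0 : ℝ) (P.shifts.length : ℝ) ∧ t₁ < t₂ ∧
    P.param t₁ = P.param t₂ ∧ R = removeLoop P t₁ t₂


/-! ### Recursive descriptions -/

/-- The trace of the polyline with start `x` and shifts `s`. -/
def Tr : ℝ × ℝ → List (ℝ × ℝ) → Set (ℝ × ℝ)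
  | x, [] => {x}
  | x, v :: s => {y | ∃ a : ℝ, 0 ≤ a ∧ a < 1 ∧ y = x + a • v} ∪ Tr (x + v) s

/-- Recursive version of simplicity. -/
def SRec : ℝ × ℝ → List (ℝ × ℝ) → Prop
  | _, [] => True
  | x, v :: s => (∀ a : ℝ, 0 ≤ a → a < 1 → x + a • v ∉ Tr (x + v) s) ∧ SRec (x + v) s

/-- No vertex is revisited later, and the end is not visited earlier. -/
def VOK : ℝ × ℝ → List (ℝ × ℝ) → Prop
  | _, [] => True
  | x, v :: s => x ∉ Tr (x + v) s ∧
      (∀ a : ℝ, 0 ≤ a → a < 1 → x + a • v ≠ x + v + s.sum) ∧ VOK (x + v) s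

lemma vert_cons (x v : ℝ × ℝ) (s : List (ℝ × ℝ)) (i : ℕ) :
    Polyline.vert ⟨x, v :: s⟩ (i + 1) = Polyline.vert ⟨x + v, s⟩ i := by
  simp [Polyline.vert, add_assoc]

lemma floor_succ (t : ℝ) (ht : 0 ≤ t) : ⌊t + 1⌋.toNat = ⌊t⌋.toNat + 1 := by
  have := Int.floor_nonneg.2 ht
  rw [Int.floor_add_one]; omega

lemma param_cons (x v : ℝ × ℝ) (s : List (ℝ × ℝ)) (t : ℝ) (ht : 0 ≤ t) :
    Polyline.param ⟨x, v :: s⟩ (t + 1) = Polyline.param ⟨x + v, s⟩ t := by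
  simp only [Polyline.param]
  rw [floor_succ t ht, vert_cons, Int.fract_add_one]
  simp

lemma param_first (x v : ℝ × ℝ) (s : List (ℝ × ℝ)) (t : ℝ) (ht : 0 ≤ t) (h1 : t < 1) :
    Polyline.param ⟨x, v :: s⟩ t = x + t • v := by
  have h : ⌊t⌋ = 0 := Int.floor_eq_zero_iff.2 ⟨ht, h1⟩
  have h' : Int.fract t = t := Int.fract_eq_self.2 ⟨ht, h1⟩
  simp [Polyline.param, h, h', Polyline.vert]

lemma param_mem (s : List (ℝ × ℝ)) : ∀ (x : ℝ × ℝ) (t : ℝ), 0 ≤ t → t ≤ s.length →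
    Polyline.param ⟨x, s⟩ t ∈ Tr x s := by
  induction s with
  | nil =>
    intro x t h0 h1
    have : t = 0 := le_antisymm (by simpa using h1) h0
    subst this
    simp [Polyline.param, Polyline.vert, Tr]
  | cons v s ih =>
    intro x t h0 h1
    rcases lt_or_ge t 1 with h | h
    · left
      exact ⟨t, h0, h, param_first x v s t h0 h⟩
    · right
      have e := param_cons x v s (t - 1) (by linarith)
      rw [sub_add_cancel] at e
      rw [e]
      push_cast [List.length_cons] at h1
      exact ih _ _ (by linarith) (by linarith)

lemma smul_inj_aux {v x : ℝ × ℝ} (hv : v ≠ 0) {a b : ℝ} (h : x + a • v = x + b • v) : a = b :=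
  smul_left_injective ℝ hv (add_left_cancel h)

lemma SRec.simple (s : List (ℝ × ℝ)) : ∀ (x : ℝ × ℝ), (∀ v ∈ s, v ≠ 0) → SRec x s →
    Polyline.Simple ⟨x, s⟩ := by
  induction s with
  | nil =>
    intro x _ _ t ht u hu _
    simp at ht hu
    rw [ht, hu]
  | cons v s ih =>
    intro x hn hs
    have hI := ih (x + v) (fun w hw => hn w (List.mem_cons_of_mem _ hw)) hs.2
    have key : ∀ t u : ℝ, 0 ≤ t → t < 1 → 1 ≤ u → u ≤ s.length + 1 →
        Polyline.param ⟨x, v :: s⟩ t ≠ Polyline.param ⟨x, v :: s⟩ u := by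
      intro t u h0 h1 h2 h3 e
      have e' := param_cons x v s (u - 1) (by linarith)
      rw [sub_add_cancel] at e'
      rw [e', param_first x v s t h0 h1] at e
      apply hs.1 t h0 h1
      rw [e]
      exact param_mem s _ _ (by linarith) (by linarith)
    intro t ht u hu e
    simp only [List.length_cons, Set.mem_Icc, Nat.cast_add, Nat.cast_one] at ht hu
    rcases lt_or_ge t 1 with h | h <;> rcases lt_or_ge u 1 with h' | h'
    · rw [param_first x v s t ht.1 h, param_first x v s u hu.1 h'] at e
      exact smul_inj_aux (hn v (by simp)) e
    · exact absurd e (key t u ht.1 h h' hu.2)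
    · exact absurd e.symm (key u t hu.1 h' h ht.2)
    · have e1 := param_cons x v s (u - 1) (by linarith)
      have e2 := param_cons x v s (t - 1) (by linarith)
      rw [sub_add_cancel] at e1 e2
      rw [e1, e2] at e
      have := hI (x₁ := t - 1) (x₂ := u - 1) ⟨by linarith, by show _ ≤ (s.length : ℝ); linarith⟩
        ⟨by linarith, by show _ ≤ (s.length : ℝ); linarith⟩ e
      linarith

lemma start_mem (x : ℝ × ℝ) (s : List (ℝ × ℝ)) : x ∈ Tr x s := by
  cases s with
  | nil => simp [Tr]
  | cons v s => left; exact ⟨0, le_refl _, one_pos, by simp⟩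

lemma Tr_compact (s : List (ℝ × ℝ)) : ∀ x, IsCompact (Tr x s) := by
  induction s with
  | nil => intro x; exact isCompact_singleton
  | cons v s ih =>
    intro x
    have : Tr x (v :: s) = (fun a : ℝ => x + a • v) '' Set.Icc 0 1 ∪ Tr (x + v) s := by
      ext y
      constructor
      · rintro (⟨a, h0, h1, rfl⟩ | h)
        · left; exact ⟨a, ⟨h0, h1.le⟩, rfl⟩
        · right; exact h
      · rintro (⟨a, ⟨h0, h1⟩, rfl⟩ | h)
        · rcases h1.lt_or_eq with h | rfl
          · left; exact ⟨a, h0, h, rfl⟩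
          · right; simpa using start_mem (x + v) s
        · right; exact h
    rw [this]
    exact (isCompact_Icc.image (by fun_prop)).union (ih _)

/-- Decomposition at the last visit of a point. -/
lemma last_visit (s : List (ℝ × ℝ)) : ∀ (x y : ℝ × ℝ), y ∈ Tr x s → y ≠ x + s.sum →
    ∃ (s₁ : List (ℝ × ℝ)) (w : ℝ × ℝ) (s₂ : List (ℝ × ℝ)) (b : ℝ), s = s₁ ++ w :: s₂ ∧
      0 ≤ b ∧ b < 1 ∧ y = x + s₁.sum + b • w ∧ y ∉ Tr (x + s₁.sum + w) s₂ := by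
  induction s with
  | nil => intro x y h hne; simp [Tr] at h hne; exact absurd h hne
  | cons v s ih =>
    intro x y h hne
    by_cases hy : y ∈ Tr (x + v) s
    · obtain ⟨s₁, w, s₂, b, e, h0, h1, h2, h3⟩ := ih (x + v) y hy
        (by simpa [add_assoc] using hne)
      exact ⟨v :: s₁, w, s₂, b, by simp [e], h0, h1, by simp [h2, add_assoc],
        by simpa [add_assoc] using h3⟩
    · rcases h with ⟨a, h0, h1, e⟩ | h
      · exact ⟨[], v, s, a, rfl, h0, h1, by simpa using e, by simpa using hy⟩
      · exact absurd h hy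

lemma Tr_append (s₁ : List (ℝ × ℝ)) : ∀ (x : ℝ × ℝ) (s₂ : List (ℝ × ℝ)),
    Tr (x + s₁.sum) s₂ ⊆ Tr x (s₁ ++ s₂) := by
  induction s₁ with
  | nil => intro x s₂; simp
  | cons v s₁ ih =>
    intro x s₂
    have := ih (x + v) s₂
    rw [add_assoc] at this
    rw [List.sum_cons]
    exact this.trans Set.subset_union_right

lemma VOK_append (s₁ : List (ℝ × ℝ)) : ∀ (x : ℝ × ℝ) (s₂ : List (ℝ × ℝ)),
    VOK x (s₁ ++ s₂) → VOK (x + s₁.sum) s₂ := by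
  induction s₁ with
  | nil => intro x s₂; simp
  | cons v s₁ ih =>
    intro x s₂ h
    rw [List.sum_cons, ← add_assoc]
    exact ih _ _ h.2.2

lemma cut_aux (z w : ℝ × ℝ) (b : ℝ) : z + b • w + (1 - b) • w = z + w := by
  rw [add_assoc, ← add_smul]; simp

lemma Tr_cut (z w : ℝ × ℝ) (s : List (ℝ × ℝ)) (b : ℝ) (h0 : 0 ≤ b) (h1 : b < 1) :
    Tr (z + b • w) ((1 - b) • w :: s) ⊆ Tr z (w :: s) := by
  rintro y (⟨a, ha0, ha1, rfl⟩ | h)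
  · left
    refine ⟨b + a * (1 - b), by nlinarith, by nlinarith, ?_⟩
    rw [smul_smul, add_assoc, ← add_smul]
  · right
    rwa [cut_aux] at h

lemma VOK_cut (z w : ℝ × ℝ) (s : List (ℝ × ℝ)) (b : ℝ) (h0 : 0 ≤ b) (h1 : b < 1)
    (h : VOK z (w :: s)) (hy : z + b • w ∉ Tr (z + w) s) :
    VOK (z + b • w) ((1 - b) • w :: s) := by
  refine ⟨by rwa [cut_aux], ?_, by rw [cut_aux]; exact h.2.2⟩
  intro a ha0 ha1
  rw [cut_aux, smul_smul, add_assoc z, ← add_smul]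
  exact h.2.1 _ (by nlinarith) (by nlinarith)

/-! ### Rotation -/

lemma cplx_smul (c : ℝ) (v : ℝ × ℝ) : (((c • v).1 : ℂ) + ((c • v).2 : ℂ) * Complex.I) =
    (c : ℂ) * ((v.1 : ℂ) + (v.2 : ℂ) * Complex.I) := by
  simp; ring

lemma cplx_ne {v : ℝ × ℝ} (hv : v ≠ 0) : ((v.1 : ℂ) + (v.2 : ℂ) * Complex.I) ≠ 0 := by
  intro h
  apply hv
  have h1 := congrArg Complex.re h
  have h2 := congrArg Complex.im h
  simp at h1 h2
  exact Prod.ext h1 h2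

lemma vangle_smul_right (v w : ℝ × ℝ) (c : ℝ) (hc : 0 < c) : vangle v (c • w) = vangle v w := by
  unfold vangle
  rw [cplx_smul, mul_div_assoc, Complex.arg_real_mul _ hc]

lemma vangle_smul_left (v w : ℝ × ℝ) (c : ℝ) (hc : 0 < c) : vangle (c • v) w = vangle v w := by
  unfold vangle
  rw [cplx_smul, div_mul_eq_div_div_swap, div_eq_mul_inv _ (c : ℂ), mul_comm,
    ← Complex.ofReal_inv, Complex.arg_real_mul _ (inv_pos.2 hc)]

lemma rot_smul_head (c : ℝ) (hc : 0 < c) (v : ℝ × ℝ) (s : List (ℝ × ℝ)) :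
    rotShifts (c • v :: s) = rotShifts (v :: s) := by
  cases s with
  | nil => simp [rotShifts]
  | cons w s => simp [rotShifts, vangle_smul_left _ _ _ hc]

lemma rot_append (p : List (ℝ × ℝ)) (w : ℝ × ℝ) (q : List (ℝ × ℝ)) :
    rotShifts (p ++ w :: q) = rotShifts (p ++ [w]) + rotShifts (w :: q) := by
  induction p with
  | nil => simp [rotShifts]
  | cons v p ih =>
    cases p with
    | nil => simp [rotShifts]
    | cons u p =>
      simp only [List.cons_append, rotShifts] at ih ⊢
      rw [ih]; ring

lemma vangle_coe {v w : ℝ × ℝ} (hv : v ≠ 0) (hw : w ≠ 0) : (vangle v w : Real.Angle) =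
    ((Complex.arg ((w.1 : ℂ) + w.2 * Complex.I) : ℝ) : Real.Angle) -
      ((Complex.arg ((v.1 : ℂ) + v.2 * Complex.I) : ℝ) : Real.Angle) :=
  Complex.arg_div_coe_angle (cplx_ne hw) (cplx_ne hv)

lemma rot_coe (p : List (ℝ × ℝ)) : ∀ (v w : ℝ × ℝ), v ≠ 0 → w ≠ 0 → (∀ u ∈ p, u ≠ 0) →
    (rotShifts (v :: (p ++ [w])) : Real.Angle) = (vangle v w : Real.Angle) := by
  induction p with
  | nil => intro v w _ _ _; simp [rotShifts]
  | cons u p ih =>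
    intro v w hv hw hp
    have hu := hp u (by simp)
    have := ih u w hu hw (fun z hz => hp z (List.mem_cons_of_mem _ hz))
    simp only [List.cons_append, rotShifts, Real.Angle.coe_add]
    rw [this, vangle_coe hv hu, vangle_coe hu hw, vangle_coe hv hw]
    abel

lemma rot_loop (p : List (ℝ × ℝ)) (v w : ℝ × ℝ) (hv : v ≠ 0) (hw : w ≠ 0)
    (hp : ∀ u ∈ p, u ≠ 0) (h : -π < rotShifts (v :: (p ++ [w]))) :
    vangle v w ≤ rotShifts (v :: (p ++ [w])) := by
  have e := rot_coe p v w hv hw hp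
  rw [Real.Angle.angle_eq_iff_two_pi_dvd_sub] at e
  obtain ⟨k, hk⟩ := e
  have h1 : vangle v w ≤ π := Complex.arg_le_pi _
  have hpi := Real.pi_pos
  have h3 : (-1 : ℝ) < k := by
    by_contra hcon
    push Not at hcon
    nlinarith
  have h4 : (0 : ℤ) ≤ k := by
    have : (-1 : ℤ) < k := by exact_mod_cast h3
    omega
  have h5 : (0 : ℝ) ≤ k := by exact_mod_cast h4
  nlinarith

/-- All contiguous pieces have rotation larger than `-π`. -/
def InfOK (s : List (ℝ × ℝ)) : Prop := ∀ t, t <:+: s → -π < rotShifts t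

lemma InfOK.of_aco (s : List (ℝ × ℝ)) (h : -π < acoShifts s) : InfOK s := by
  intro t ht
  refine h.trans_le (csInf_le ?_ ⟨t, ht, rfl⟩)
  apply Set.Finite.bddBelow
  apply Set.Finite.image
  apply (List.finite_toSet s.sublists).subset
  intro u hu
  exact List.mem_sublists.2 hu.sublist

lemma InfOK.mono {s t : List (ℝ × ℝ)} (h : InfOK s) (ht : t <:+: s) : InfOK t :=
  fun u hu => h u (hu.trans ht)

lemma InfOK.smul_head {w : ℝ × ℝ} {s : List (ℝ × ℝ)} (h : InfOK (w :: s)) (c : ℝ) (hc : 0 < c) :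
    InfOK (c • w :: s) := by
  intro t ht
  rcases List.infix_cons_iff.1 ht with hp | hi
  · cases t with
    | nil => exact h [] (List.nil_infix)
    | cons u t =>
      obtain ⟨rfl, hp'⟩ := List.cons_prefix_cons.1 hp
      rw [rot_smul_head c hc]
      exact h _ (List.IsPrefix.isInfix (List.cons_prefix_cons.2 ⟨rfl, hp'⟩))
  · exact h t (List.infix_cons hi)

/-! ### Loop removal steps -/

lemma removeLoop_cons (x v : ℝ × ℝ) (s : List (ℝ × ℝ)) (t₁ t₂ : ℝ) (h1 : 0 ≤ t₁) (h2 : 0 ≤ t₂) :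
    removeLoop ⟨x, v :: s⟩ (t₁ + 1) (t₂ + 1) =
      ⟨x, v :: (removeLoop ⟨x + v, s⟩ t₁ t₂).shifts⟩ := by
  simp only [removeLoop]
  rw [floor_succ t₁ h1, floor_succ t₂ h2, Int.fract_add_one, Int.fract_add_one,
    param_cons x v s t₁ h1, param_cons x v s t₂ h2, vert_cons, vert_cons,
    add_right_comm _ 1]
  simp

lemma step_cons (v : ℝ × ℝ) (Q R : Polyline) (h : LoopRemovalStep Q R) :
    LoopRemovalStep ⟨Q.start - v, v :: Q.shifts⟩ ⟨R.start - v, v :: R.shifts⟩ := by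
  obtain ⟨t₁, t₂, h1, h2, hlt, he, rfl⟩ := h
  refine ⟨t₁ + 1, t₂ + 1, ?_, ?_, by linarith, ?_, ?_⟩
  · exact ⟨by linarith [h1.1], by push_cast [List.length_cons]; linarith [h1.2]⟩
  · exact ⟨by linarith [h2.1], by push_cast [List.length_cons]; linarith [h2.2]⟩
  · rw [param_cons _ _ _ _ h1.1, param_cons _ _ _ _ h2.1, sub_add_cancel]
    exact he
  · rw [removeLoop_cons _ _ _ _ _ h1.1 h2.1, sub_add_cancel]
    rfl

lemma steps_cons (x v : ℝ × ℝ) (s r : List (ℝ × ℝ))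
    (h : Relation.ReflTransGen LoopRemovalStep ⟨x + v, s⟩ ⟨x + v, r⟩) :
    Relation.ReflTransGen LoopRemovalStep ⟨x, v :: s⟩ ⟨x, v :: r⟩ := by
  have := Relation.ReflTransGen.lift
    (fun Q : Polyline => (⟨Q.start - v, v :: Q.shifts⟩ : Polyline)) (fun Q R => step_cons v Q R) _ _ h
  simpa [Function.onFun] using this

lemma step_first (x v : ℝ × ℝ) (s₁ : List (ℝ × ℝ)) (w : ℝ × ℝ) (s₂ : List (ℝ × ℝ)) (a b : ℝ)
    (ha0 : 0 < a) (ha1 : a < 1) (hb0 : 0 ≤ b) (hb1 : b < 1)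
    (he : x + a • v = x + v + s₁.sum + b • w) :
    LoopRemovalStep ⟨x, v :: (s₁ ++ w :: s₂)⟩ ⟨x, a • v :: (1 - b) • w :: s₂⟩ := by
  have fa : ⌊a⌋ = 0 := Int.floor_eq_zero_iff.2 ⟨ha0.le, ha1⟩
  have fa' : Int.fract a = a := Int.fract_eq_self.2 ⟨ha0.le, ha1⟩
  have fb0 : ⌊b⌋ = 0 := Int.floor_eq_zero_iff.2 ⟨hb0, hb1⟩
  have fb : ⌊b + ((s₁.length + 1 : ℕ) : ℝ)⌋.toNat = s₁.length + 1 := by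
    rw [Int.floor_add_natCast, fb0]; omega
  have fb' : Int.fract (b + ((s₁.length + 1 : ℕ) : ℝ)) = b := by
    rw [Int.fract_add_natCast]; exact Int.fract_eq_self.2 ⟨hb0, hb1⟩
  have pb : Polyline.param ⟨x, v :: (s₁ ++ w :: s₂)⟩ (b + ((s₁.length + 1 : ℕ) : ℝ)) =
      x + v + s₁.sum + b • w := by
    simp only [Polyline.param]
    rw [fb, fb']
    simp [Polyline.vert, add_assoc]
  have pa : Polyline.param ⟨x, v :: (s₁ ++ w :: s₂)⟩ a = x + a • v :=
    param_first _ _ _ _ ha0.le ha1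
  refine ⟨a, b + ((s₁.length + 1 : ℕ) : ℝ), ⟨ha0.le, ?_⟩, ⟨by positivity, ?_⟩, ?_, ?_, ?_⟩
  · push_cast [List.length_cons, List.length_append]
    have : (0 : ℝ) ≤ s₁.length := by positivity
    have : (0 : ℝ) ≤ s₂.length := by positivity
    linarith
  · push_cast [List.length_cons, List.length_append]
    have : (0 : ℝ) ≤ s₂.length := by positivity
    linarith
  · push_cast
    have : (0 : ℝ) ≤ s₁.length := by positivity
    linarith
  · rw [pa, pb, he]
  · have hv1 : Polyline.vert ⟨x, v :: (s₁ ++ w :: s₂)⟩ (s₁.length + 1 + 1) =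
        x + v + s₁.sum + w := by
      simp [Polyline.vert, add_assoc, List.take_append, List.take_of_length_le]
    have hd : (x + v + s₁.sum + w) - (x + v + s₁.sum + b • w) = (1 - b) • w := by
      rw [sub_smul, one_smul]; abel
    have hv0 : Polyline.vert ⟨x, v :: (s₁ ++ w :: s₂)⟩ 0 = x := by simp [Polyline.vert]
    simp only [removeLoop]
    rw [fb, fb', pa, pb, fa, fa', hv1, hd]
    by_cases hb : b = 0
    · subst hb
      simp [ha0.ne', hv0]
    · simp [ha0.ne', hv0, hb, List.drop_append]

/-! ### Main induction -/

lemma main_ind (n : ℕ) : ∀ (s : List (ℝ × ℝ)) (x v : ℝ × ℝ), s.length ≤ n →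
    (∀ u ∈ v :: s, u ≠ 0) → InfOK (v :: s) → VOK x (v :: s) →
    ∃ (c : ℝ) (r : List (ℝ × ℝ)), 0 < c ∧
      Relation.ReflTransGen LoopRemovalStep ⟨x, v :: s⟩ ⟨x, c • v :: r⟩ ∧
      SRec x (c • v :: r) ∧ Tr x (c • v :: r) ⊆ Tr x (v :: s) ∧
      x + (c • v :: r).sum = x + (v :: s).sum ∧ (∀ u ∈ c • v :: r, u ≠ 0) ∧
      rotShifts (c • v :: r) ≤ rotShifts (v :: s) := by
  induction n with
  | zero =>
    intro s x v hs hn hI hV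
    have : s = [] := List.length_eq_zero_iff.1 (by omega)
    subst this
    refine ⟨1, [], one_pos, ?_⟩
    rw [one_smul]
    refine ⟨.refl, ⟨?_, trivial⟩, subset_rfl, rfl, hn, le_rfl⟩
    intro a h0 h1 he
    exact hV.2.1 a h0 h1 (by simpa [Tr] using he)
  | succ n ih =>
    intro s x v hs hn hI hV
    have hv : v ≠ 0 := hn v (by simp)
    by_cases hcross : ∃ a : ℝ, 0 ≤ a ∧ a < 1 ∧ x + a • v ∈ Tr (x + v) s
    · -- there is a crossing: take the first one on the first edge
      have hcl : IsClosed ((fun a : ℝ => x + a • v) ⁻¹' Tr (x + v) s) :=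
        (Tr_compact s (x + v)).isClosed.preimage (by fun_prop)
      have hcomp : IsCompact (Set.Icc (0 : ℝ) 1 ∩ (fun a : ℝ => x + a • v) ⁻¹' Tr (x + v) s) :=
        isCompact_Icc.inter_right hcl
      obtain ⟨a₀, h00, h01, h02⟩ := hcross
      obtain ⟨a, ⟨⟨ha0, ha1⟩, hmem⟩, hmin⟩ := hcomp.exists_isLeast ⟨a₀, ⟨h00, h01.le⟩, h02⟩
      have haa : a ≤ a₀ := hmin ⟨⟨h00, h01.le⟩, h02⟩
      have ha1' : a < 1 := lt_of_le_of_lt haa h01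
      have ha0' : 0 < a := by
        rcases ha0.lt_or_eq with h | h
        · exact h
        · subst h
          exfalso
          apply hV.1
          simpa using hmem
      obtain ⟨s₁, w, s₂, b, rfl, hb0, hb1, hy, hlast⟩ :=
        last_visit s (x + v) (x + a • v) hmem (hV.2.1 a ha0 ha1')
      have hw : w ≠ 0 := hn w (by simp)
      have hb' : 0 < 1 - b := by linarith
      have hVw : VOK (x + v + s₁.sum) (w :: s₂) := VOK_append s₁ _ _ hV.2.2
      have hVy := VOK_cut _ w s₂ b hb0 hb1 hVw (by rw [← hy]; exact hlast)
      have hIw : InfOK (w :: s₂) := hI.mono (by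
        apply List.IsSuffix.isInfix
        exact ⟨v :: s₁, by simp⟩)
      rw [← hy] at hVy
      have hTr : Tr (x + a • v) ((1 - b) • w :: s₂) ⊆ Tr (x + v) (s₁ ++ w :: s₂) := by
        rw [hy]
        exact (Tr_cut _ w s₂ b hb0 hb1).trans (Tr_append s₁ _ _)
      obtain ⟨c, r, hc, hst, hsr, htr, hsum, hne, hrot⟩ := ih s₂ (x + a • v) ((1 - b) • w)
        (by simp at hs; omega)
        (by
          intro u hu
          rcases List.mem_cons.1 hu with rfl | hu
          · exact smul_ne_zero hb'.ne' hw
          · exact hn u (by simp [hu]))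
        (hIw.smul_head _ hb') hVy
      refine ⟨a, c • (1 - b) • w :: r, ha0', ?_, ⟨?_, hsr⟩, ?_, ?_, ?_, ?_⟩
      · exact (Relation.ReflTransGen.single
          (step_first x v s₁ w s₂ a b ha0' ha1' hb0 hb1 hy)).trans (steps_cons _ _ _ _ hst)
      · intro a' h0 h1 hm
        have hm' := hTr (htr hm)
        rw [smul_smul] at hm'
        have := hmin ⟨⟨mul_nonneg h0 ha0, by nlinarith⟩, hm'⟩
        nlinarith
      · rintro y (⟨a', h0, h1, rfl⟩ | h)
        · left
          exact ⟨a' * a, mul_nonneg h0 ha0, by nlinarith, by rw [smul_smul]⟩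
        · right
          exact hTr (htr h)
      · rw [List.sum_cons, ← add_assoc, hsum, List.sum_cons, ← add_assoc, hy, cut_aux]
        simp [add_assoc]
      · intro u hu
        rcases List.mem_cons.1 hu with rfl | hu
        · exact smul_ne_zero ha0'.ne' hv
        · exact hne u hu
      · have hl := rot_loop s₁ v w hv hw (fun u hu => hn u (by simp [hu]))
          (hI _ (by
            apply List.IsPrefix.isInfix
            exact ⟨s₂, by simp⟩))
        have e1 := rot_append (v :: s₁) w s₂
        rw [List.cons_append, List.cons_append] at e1
        rw [e1]
        rw [rot_smul_head a ha0']
        rw [rot_smul_head _ hb'] at hrot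
        simp only [rotShifts] at hrot ⊢
        rw [vangle_smul_right _ _ _ hc, vangle_smul_right _ _ _ hb']
        linarith
    · -- no crossing on the first edge
      push Not at hcross
      cases s with
      | nil =>
        refine ⟨1, [], one_pos, ?_⟩
        rw [one_smul]
        exact ⟨.refl, ⟨hcross, trivial⟩, subset_rfl, rfl, hn, le_rfl⟩
      | cons v' s' =>
        obtain ⟨c, r, hc, hst, hsr, htr, hsum, hne, hrot⟩ := ih s' (x + v) v'
          (by simp at hs; omega) (fun u hu => hn u (List.mem_cons_of_mem _ hu))
          (hI.mono (List.infix_cons List.infix_rfl)) hV.2.2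
        refine ⟨1, c • v' :: r, one_pos, ?_⟩
        rw [one_smul]
        refine ⟨steps_cons _ _ _ _ hst, ⟨?_, hsr⟩, ?_, ?_, ?_, ?_⟩
        · intro a h0 h1 hm
          exact hcross a h0 h1 (htr hm)
        · exact Set.union_subset_union_right _ htr
        · rw [List.sum_cons, ← add_assoc, hsum, List.sum_cons (a := v), ← add_assoc]
        · intro u hu
          rcases List.mem_cons.1 hu with rfl | hu
          · exact hv
          · exact hne u hu
        · simp only [rotShifts] at hrot ⊢
          rw [vangle_smul_right _ _ _ hc]
          linarith

/-! ### General position -/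

lemma mem_Tr_edge (s : List (ℝ × ℝ)) : ∀ (x y : ℝ × ℝ), y ∈ Tr x s →
    (∃ j, j < s.length ∧ y ∈ Polyline.edge ⟨x, s⟩ j) ∨ y = x + s.sum := by
  induction s with
  | nil => intro x y h; right; simpa [Tr] using h
  | cons v s ih =>
    rintro x y (⟨a, h0, h1, rfl⟩ | h)
    · left
      refine ⟨0, by simp, ?_⟩
      rw [Polyline.edge, segment_eq_image']
      exact ⟨a, ⟨h0, h1.le⟩, by simp [Polyline.vert]⟩
    · rcases ih _ _ h with ⟨j, hj, hy⟩ | rfl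
      · left
        refine ⟨j + 1, by simpa using hj, ?_⟩
        simpa only [Polyline.edge, vert_cons] using hy
      · right; simp [add_assoc]

lemma edge_cons (x v : ℝ × ℝ) (s : List (ℝ × ℝ)) (i : ℕ) :
    Polyline.edge ⟨x, v :: s⟩ (i + 1) = Polyline.edge ⟨x + v, s⟩ i := by
  simp only [Polyline.edge, vert_cons]

lemma GP_tail (x v : ℝ × ℝ) (s : List (ℝ × ℝ)) (h : Polyline.GeneralPosition ⟨x, v :: s⟩) :
    Polyline.GeneralPosition ⟨x + v, s⟩ := by
  obtain ⟨h1, h2, h3⟩ := h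
  refine ⟨?_, ?_, ?_⟩
  · intro i j hij hj
    have := h1 (i + 1) (j + 1) (by omega) (by simpa using hj)
    rwa [vert_cons, vert_cons] at this
  · intro i j hij hj
    have := h2 (i + 1) (j + 1) (by omega) (by simpa using hj)
    simp only [vert_cons, edge_cons] at this
    refine ⟨this.1, fun y hy => ?_⟩
    rcases this.2 y hy with h | h
    · left; exact ⟨by omega, h.2⟩
    · right; exact h
  · intro i j k hij hjk hk
    have := h3 (i + 1) (j + 1) (k + 1) (by omega) (by omega) (by simpa using hk)
    simpa only [edge_cons] using this

lemma not_mem_left {p q : ℝ × ℝ} (h : p ≠ q) : p ∉ openSegment ℝ p q := by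
  rw [left_mem_openSegment_iff]; exact h

lemma not_mem_right {p q : ℝ × ℝ} (h : p ≠ q) : q ∉ openSegment ℝ p q := by
  rw [right_mem_openSegment_iff]; exact h

lemma vert_end (x : ℝ × ℝ) (s : List (ℝ × ℝ)) :
    Polyline.vert ⟨x, s⟩ s.length = x + s.sum := by
  simp [Polyline.vert]

lemma GP_VOK (s : List (ℝ × ℝ)) : ∀ x, Polyline.GeneralPosition ⟨x, s⟩ → VOK x s := by
  induction s with
  | nil => intro x _; trivial
  | cons v s ih =>
    intro x h
    obtain ⟨h1, h2, -⟩ := id h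
    have v0 : Polyline.vert ⟨x, v :: s⟩ 0 = x := by simp [Polyline.vert]
    have v1 : Polyline.vert ⟨x, v :: s⟩ 1 = x + v := by simp [Polyline.vert]
    have vn : Polyline.vert ⟨x, v :: s⟩ (s.length + 1) = x + v + s.sum := by
      rw [vert_cons, vert_end]
    refine ⟨?_, ?_, ih _ (GP_tail _ _ _ h)⟩
    · intro hm
      rcases mem_Tr_edge _ _ _ hm with ⟨j, hj, hy⟩ | he
      · rw [← edge_cons] at hy
        have hx0 : x ∈ Polyline.edge ⟨x, v :: s⟩ 0 := by
          rw [Polyline.edge, v0]; exact left_mem_segment _ _ _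
        rcases (h2 0 (j + 1) (by omega) (by simpa using hj)).2 x ⟨hx0, hy⟩ with h | h
        · exact h1 0 (j + 1) (by omega) (by simp; omega) (v0.trans h.2)
        · have hne := h1 0 1 (by omega) (by simp)
          have := h.1
          simp only [zero_add] at this
          rw [v0] at this hne
          exact not_mem_left hne this
      · exact h1 0 (s.length + 1) (by omega) (by simp) (by rw [v0, vn]; exact he)
    · intro a ha0 ha1 he
      rcases Nat.eq_zero_or_pos s.length with hs | hs
      · have : s = [] := List.length_eq_zero_iff.1 hs
        subst this
        have hne := h1 0 1 (by omega) (by simp)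
        rw [v0, v1] at hne
        have hv : v ≠ 0 := by rintro rfl; simp at hne
        have : a = 1 := smul_inj_aux (x := x) hv (by simpa using he)
        linarith
      · obtain ⟨m, hm⟩ : ∃ m, s.length = m + 1 := ⟨s.length - 1, by omega⟩
        rw [hm] at vn
        have hy0 : x + v + s.sum ∈ Polyline.edge ⟨x, v :: s⟩ 0 := by
          rw [Polyline.edge, segment_eq_image']
          refine ⟨a, ⟨ha0, ha1.le⟩, ?_⟩
          rw [← he]
          simp [Polyline.vert]
        have hy1 : x + v + s.sum ∈ Polyline.edge ⟨x, v :: s⟩ (m + 1) := by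
          rw [Polyline.edge, vn]; exact right_mem_segment _ _ _
        have hne := h1 (m + 1) (m + 1 + 1) (by omega) (by simp; omega)
        rcases (h2 0 (m + 1) (by omega) (by simp; omega)).2 _ ⟨hy0, hy1⟩ with h | h
        · exact hne (by rw [vn]; exact h.2.symm)
        · have := h.2
          nth_rewrite 1 [← vn] at this
          exact not_mem_right hne this

/-- **Lemma (elimination of all loops).** Let `P` be a polyline in general
position with `aco P > -π`. Then by successive loop removals all loops of `P`
can be removed, producing a simple polyline with the same endpoints as `P`
whose rotation does not exceed `rot P`. -/
theorem eliminate_loops (P : Polyline) (hP : P.Proper)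
    (hNR : NonReverse P.shifts) (hgen : P.GeneralPosition)
    (haco : -π < acoShifts P.shifts) :
    ∃ R : Polyline, Relation.ReflTransGen LoopRemovalStep P R ∧
      R.Simple ∧ R.start = P.start ∧
      R.vert R.shifts.length = P.vert P.shifts.length ∧
      rotShifts R.shifts ≤ rotShifts P.shifts := by
  obtain ⟨x, s⟩ := P
  cases s with
  | nil => exact absurd rfl hP.1
  | cons v s =>
    obtain ⟨c, r, hc, hst, hsr, htr, hsum, hne, hrot⟩ := main_ind s.length s x v le_rfl hP.2
      (InfOK.of_aco _ haco) (GP_VOK _ _ hgen)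
    refine ⟨⟨x, c • v :: r⟩, hst, SRec.simple _ _ hne hsr, rfl, ?_, hrot⟩
    simp only [vert_end]
    exact hsum
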